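/- Let 𝔽 be ℝ or ℂ and let n, m, p be positive integers with n ≤ m and p even. Then 2 · max.rank_𝔽(n,m,p) ≤ m(p−1) + 2n. -/

import Mathlib

/-- The rank of a 3-tensor, presented as a family of matrices (its slices):
the least `r` such that each slice `A k` is `∑ i, (c i k) • (a i) (b i)ᵀ`
for some vectors `a i`, `b i`, `c i`. -/
noncomputable def tensorRank (𝔽 : Type*) [Field 𝔽] {α β γ : Type*}
    [Fintype α] [Fintype β] [Fintype γ] (A : γ → Matrix α β 𝔽) : ℕ :=
  sInf {r : ℕ | ∃ (a : Fin r → α → 𝔽) (b : Fin r → β → 𝔽) (c : Fin r → γ → 𝔽),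
    ∀ k, A k = ∑ i, c i k • Matrix.vecMulVec (a i) (b i)}

/-- `maxRank 𝔽 m n p` is the maximal rank of an `m × n × p` tensor over `𝔽`. -/
noncomputable def maxRank (𝔽 : Type*) [Field 𝔽] (m n p : ℕ) : ℕ :=
  sSup {r : ℕ | ∃ A : Fin p → Matrix (Fin m) (Fin n) 𝔽, tensorRank 𝔽 A = r}

section LinearFamilies

open Module Polynomial

section Diagonalizable

variable {F V W : Type*} [Field F] [AddCommGroup V] [Module F V] [AddCommGroup W] [Module F W]

theorem LinearMap.comp_aeval_of_comp_eq {f : V →ₗ[F] W} {M : End F V} {N : End F W}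
    (h : f ∘ₗ M = N ∘ₗ f) (p : F[X]) : f ∘ₗ aeval M p = aeval N p ∘ₗ f := by
  induction p using Polynomial.induction_on' with
  | add p q hp hq => simp only [map_add, LinearMap.comp_add, LinearMap.add_comp, hp, hq]
  | monomial n a =>
    simp only [aeval_monomial]
    ext x
    have key : ∀ n x, f ((M ^ n) x) = (N ^ n) (f x) := by
      intro n
      induction n with
      | zero => simp
      | succ n ih =>
        intro x
        simp only [pow_succ, Module.End.mul_apply, ih]
        exact congrArg _ (LinearMap.congr_fun h x)
    simp [key]

theorem LinearMap.finrank_range_add_le [FiniteDimensional F W] (f g : V →ₗ[F] W) :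
    finrank F (range (f + g)) ≤ finrank F (range f) + finrank F (range g) := by
  refine (Submodule.finrank_mono ?_).trans (Submodule.finrank_add_le_finrank_add_finrank _ _)
  rintro _ ⟨x, rfl⟩
  exact Submodule.add_mem_sup ⟨x, rfl⟩ ⟨x, rfl⟩

theorem LinearMap.finrank_range_comp_comp_le {V' W' : Type*} [AddCommGroup V'] [Module F V']
    [AddCommGroup W'] [Module F W'] [FiniteDimensional F W]
    (f : W →ₗ[F] W') (g : V →ₗ[F] W) (h : V' →ₗ[F] V) :
    finrank F (range (f ∘ₗ g ∘ₗ h)) ≤ finrank F (range g) := by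
  rw [LinearMap.range_comp]
  exact (Submodule.finrank_map_le _ _).trans
    (Submodule.finrank_mono (LinearMap.range_comp_le_range _ _))

theorem LinearMap.finrank_range_smulRight_le (f : Dual F V) (w : W) :
    finrank F (range (f.smulRight w)) ≤ 1 := by
  have : range (f.smulRight w) ≤ Submodule.span F {w} := by
    rintro _ ⟨x, rfl⟩
    exact Submodule.smul_mem _ _ (Submodule.mem_span_singleton_self w)
  exact (Submodule.finrank_mono this).trans ((finrank_span_le_card {w}).trans (by simp))

/-- The split separable polynomial with root set `s`. -/
noncomputable def rootPoly (s : Finset F) : F[X] := ∏ a ∈ s, (X - C a)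

theorem aeval_rootPoly_insert [DecidableEq F] {s : Finset F} {a : F} (ha : a ∉ s) (M : End F V)
    (x : V) : aeval M (rootPoly (insert a s)) x =
      aeval M (rootPoly s) (M x - a • x) := by
  rw [rootPoly, Finset.prod_insert ha, mul_comm, map_mul]
  simp [rootPoly, Module.algebraMap_end_apply]

theorem aeval_rootPoly_insert' [DecidableEq F] {s : Finset F} {a : F} (ha : a ∉ s) (M : End F V)
    (x : V) : aeval M (rootPoly (insert a s)) x =
      M (aeval M (rootPoly s) x) - a • aeval M (rootPoly s) x := by
  rw [rootPoly, Finset.prod_insert ha, map_mul]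
  simp [rootPoly, Module.algebraMap_end_apply]

/-- An operator killed by a split separable polynomial has an eigenbasis. -/
theorem exists_eigenbasis [FiniteDimensional F V] {M : End F V} {s : Finset F}
    (h : aeval M (rootPoly s) = 0) :
    ∃ (g : Basis (Fin (finrank F V)) F V) (μ : Fin (finrank F V) → F), ∀ i, M (g i) = μ i • g i := by
  classical
  have key : ∀ s : Finset F, LinearMap.ker (aeval M (rootPoly s)) ≤
      Submodule.span F {x | ∃ c : F, M x = c • x} := by
    intro s
    induction s using Finset.induction_on with
    | empty => intro x hx; simp [rootPoly] at hx; simp [hx]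
    | insert a s ha ih =>
      have hc : IsCoprime (X - C a) (rootPoly s) := by
        refine IsCoprime.prod_right fun b hb => ?_
        exact isCoprime_X_sub_C_of_isUnit_sub (sub_ne_zero.2 fun e : a = b => ha (by rwa [e])).isUnit
      rw [rootPoly, Finset.prod_insert ha, ← rootPoly,
        ← Polynomial.sup_ker_aeval_eq_ker_aeval_mul_of_coprime _ hc]
      refine sup_le (fun x hx => Submodule.subset_span ⟨a, ?_⟩) ih
      simpa [Module.algebraMap_end_apply, sub_eq_zero] using hx
  have hs : ⊤ ≤ Submodule.span F {x | ∃ c : F, M x = c • x} := by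
    refine le_trans ?_ (key s)
    rw [h, LinearMap.ker_zero]
  let b := Basis.ofSpan hs
  let g := b.reindex (b.indexEquiv (finBasis F V))
  have hg : ∀ i, ∃ c : F, M (g i) = c • g i := fun i =>
    Basis.ofSpan_subset hs ⟨(b.indexEquiv (finBasis F V)).symm i, by simp [g, b]⟩
  choose μ hμ using hg
  exact ⟨g, μ, hμ⟩

end Diagonalizable

/-- Every operator becomes diagonalizable after a perturbation of rank at most half the
dimension. -/
theorem exists_perturb_diagonalizable {F : Type*} [Field F] [Infinite F] (n : ℕ) :
    ∀ (V : Type*) [AddCommGroup V] [Module F V] [FiniteDimensional F V], finrank F V = n →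
      ∀ P : End F V, ∃ (X : End F V) (s : Finset F),
        2 * finrank F (LinearMap.range X) ≤ finrank F V ∧ aeval (P - X) (rootPoly s) = 0 := by
  classical
  induction n using Nat.strong_induction_on with
  | _ n ih =>
  intro V _ _ _ hn P
  by_cases hP : ∃ a : F, P = a • LinearMap.id
  · obtain ⟨a, rfl⟩ := hP
    refine ⟨0, {a}, ?_, ?_⟩
    · rw [show LinearMap.range (0 : End F V) = ⊥ from LinearMap.range_zero]; simp
    simp only [rootPoly, Finset.prod_singleton, sub_zero, map_sub, aeval_X, aeval_C]
    ext x
    simp [Module.algebraMap_end_apply]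
  obtain ⟨v, hv⟩ : ∃ v, LinearIndependent F ![v, P v] := by
    by_contra! hcon
    obtain ⟨a, ha⟩ := P.exists_eq_smul_id_of_forall_notLinearIndependent hcon
    exact hP ⟨a, ha⟩
  have hv0 := hv
  rw [LinearIndependent.pair_iff] at hv
  obtain ⟨φ, hφv, hφ⟩ : ∃ φ : Dual F V, φ v = 0 ∧ φ (P v) = 1 := by
    have hn : P v ∉ Submodule.span F {v} := by
      rw [Submodule.mem_span_singleton]
      rintro ⟨a, ha⟩
      have := hv a (-1) (by simp [ha])
      simp at this
    obtain ⟨f, hf, hle⟩ := Submodule.exists_le_ker_of_notMem hn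
    refine ⟨(f (P v))⁻¹ • f, ?_, by simp [hf]⟩
    have : f v = 0 := hle (Submodule.mem_span_singleton_self v)
    simp [this]
  set U : Submodule F V := Submodule.span F (Set.range ![v, P v]) with hU
  have hvU : v ∈ U := Submodule.subset_span ⟨0, rfl⟩
  have hPvU : P v ∈ U := Submodule.subset_span ⟨1, rfl⟩
  have hUdim : finrank F U = 2 := by
    rw [hU, finrank_span_eq_card hv0]; simp
  have hUle : ∀ N : End F V, N v ∈ U → N (P v) ∈ U → U ≤ U.comap N := by
    intro N h0 h1
    rw [hU, Submodule.span_le]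
    rintro _ ⟨i, rfl⟩
    fin_cases i
    exacts [h0, h1]
  let P₀ : End F V := P - φ.smulRight (P (P v))
  have hP₀v : P₀ v = P v := by simp [P₀, hφv]
  have hP₀Pv : P₀ (P v) = 0 := by simp [P₀, hφ]
  have hinv : U ≤ U.comap P₀ := hUle _ (by rwa [hP₀v]) (by rw [hP₀Pv]; exact U.zero_mem)
  have hquot := Submodule.finrank_quotient_add_finrank U
  obtain ⟨Y, s, hY, hs⟩ := ih (finrank F (V ⧸ U)) (by omega) (V ⧸ U) rfl (U.mapQ U P₀ hinv)
  obtain ⟨σ, hσ⟩ := U.mkQ.exists_rightInverse_of_surjective (Submodule.range_mkQ U)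
  obtain ⟨a, ha⟩ := Infinite.exists_notMem_finset s
  obtain ⟨b, hb⟩ := Infinite.exists_notMem_finset (insert a s)
  let u : V := (a + b) • P v - (a * b) • v
  have hu : u ∈ U := U.sub_mem (U.smul_mem _ hPvU) (U.smul_mem _ hvU)
  let X₀ : End F V := σ ∘ₗ Y ∘ₗ U.mkQ
  have hX₀ : ∀ x ∈ U, X₀ x = 0 := by
    intro x hx
    have : U.mkQ x = 0 := by simpa using hx
    simp [X₀, this]
  have hσ' : ∀ y, U.mkQ (σ y) = y := fun y => LinearMap.congr_fun hσ y
  refine ⟨φ.smulRight (P (P v) - u) + X₀, insert b (insert a s), ?_, ?_⟩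
  · have h1 := LinearMap.finrank_range_add_le (φ.smulRight (P (P v) - u)) X₀
    have h2 := LinearMap.finrank_range_smulRight_le φ (P (P v) - u)
    have h3 := LinearMap.finrank_range_comp_comp_le σ Y U.mkQ
    change finrank F (LinearMap.range X₀) ≤ _ at h3
    omega
  · set M : End F V := P - (φ.smulRight (P (P v) - u) + X₀) with hM
    have hMv : M v = P v := by simp [hM, hφv, hX₀ v hvU]
    have hMPv : M (P v) = u := by simp [hM, hφ, hX₀ _ hPvU]
    have hint : U.mkQ ∘ₗ M = (U.mapQ U P₀ hinv - Y) ∘ₗ U.mkQ := by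
      ext x
      have hux : U.mkQ (φ x • u) = 0 := by
        simpa only [Submodule.mkQ_apply, Submodule.Quotient.mk_eq_zero] using U.smul_mem _ hu
      have e : M x = P₀ x - X₀ x + φ x • u := by simp [hM, P₀, smul_sub]; abel
      rw [LinearMap.comp_apply, e, map_add, hux, map_sub]
      simp only [X₀, LinearMap.comp_apply, hσ']
      simp
    have hmem : ∀ x, aeval M (rootPoly s) x ∈ U := by
      intro x
      have := LinearMap.congr_fun (LinearMap.comp_aeval_of_comp_eq hint (rootPoly s)) x
      rw [hs] at this
      simpa using this
    have hkill : ∀ x ∈ U, M (M x) - (a + b) • M x + (a * b) • x = 0 := by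
      let N : End F V := M ∘ₗ M - (a + b) • M + (a * b) • LinearMap.id
      have : U ≤ LinearMap.ker N := by
        rw [hU, Submodule.span_le]
        rintro _ ⟨i, rfl⟩
        fin_cases i
        · simp [N, hMv, hMPv, u]
        · simp [N, hMv, hMPv, u]
      intro x hx
      simpa [N] using this hx
    ext x
    rw [aeval_rootPoly_insert' hb, aeval_rootPoly_insert' ha]
    have := hkill _ (hmem x)
    simp only [map_sub, map_smul, LinearMap.zero_apply]
    rw [← this]
    module

/-- Modulo the kernel of a surjection `π`, every operator becomes diagonalizable after a perturbation
of rank at most half the dimension of the quotient. -/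
theorem exists_perturb_diagonalizable_mod_range {F V W : Type*} [Field F] [Infinite F]
    [AddCommGroup V] [Module F V] [AddCommGroup W] [Module F W] [FiniteDimensional F V]
    [FiniteDimensional F W] {π : V →ₗ[F] W} {σ : W →ₗ[F] V} (hσ : ∀ y, π (σ y) = y) (P : End F V) :
    ∃ (X M : End F V) (s : Finset F), 2 * finrank F (LinearMap.range X) ≤ finrank F W ∧
      aeval M (rootPoly s) = 0 ∧ ∀ x, π (P x - X x - M x) = 0 := by
  classical
  obtain ⟨Y, s, hY, hs⟩ := exists_perturb_diagonalizable _ W rfl (π ∘ₗ P ∘ₗ σ)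
  obtain ⟨a, ha⟩ := Infinite.exists_notMem_finset s
  set D : End F W := π ∘ₗ P ∘ₗ σ - Y with hD
  let κ : End F V := LinearMap.id - σ ∘ₗ π
  let M : End F V := a • κ + σ ∘ₗ π ∘ₗ P ∘ₗ κ + σ ∘ₗ D ∘ₗ π
  refine ⟨σ ∘ₗ Y ∘ₗ π, M, insert a s, ?_, ?_, ?_⟩
  · exact (Nat.mul_le_mul_left 2 (LinearMap.finrank_range_comp_comp_le σ Y π)).trans hY
  · have hint : σ ∘ₗ D = M ∘ₗ σ := by
      ext y; simp [M, κ, hσ]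
    ext x
    rw [aeval_rootPoly_insert ha]
    have : M x - a • x = σ (π (P (κ x)) + D (π x) - a • π x) := by
      simp only [M, κ, LinearMap.add_apply, LinearMap.smul_apply, LinearMap.comp_apply,
        LinearMap.sub_apply, LinearMap.id_apply, map_add, map_sub, map_smul]
      module
    rw [this]
    have h := LinearMap.congr_fun (LinearMap.comp_aeval_of_comp_eq hint (rootPoly s))
    simp only [LinearMap.comp_apply] at h
    rw [← h, hs]; simp
  · intro x
    simp [M, κ, hσ, hD]

theorem exists_perturb_diagonalizable_mod {F V K W : Type*} [Field F] [Infinite F]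
    [AddCommGroup V] [Module F V] [AddCommGroup W] [Module F W] [AddCommGroup K] [Module F K]
    [FiniteDimensional F V] [FiniteDimensional F W] [FiniteDimensional F K]
    {ι : K →ₗ[F] V} {ρ : V →ₗ[F] K} (hρ : ∀ x, ρ (ι x) = x)
    {π : K →ₗ[F] W} (hπ : Function.Surjective π) (P : End F V) :
    ∃ (X M : End F V) (s : Finset F), 2 * finrank F (LinearMap.range X) ≤ finrank F W ∧
      aeval M (rootPoly s) = 0 ∧
      ∀ x, ∃ y, π y = 0 ∧ P (ι x) - X (ι x) - M (ι x) = ι y := by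
  classical
  obtain ⟨σ, hσ⟩ := π.exists_rightInverse_of_surjective (LinearMap.range_eq_top.2 hπ)
  obtain ⟨Y, D, s, hY, hs, hmod⟩ := exists_perturb_diagonalizable_mod_range
    (fun y => LinearMap.congr_fun hσ y) (ρ ∘ₗ P ∘ₗ ι)
  obtain ⟨a, ha⟩ := Infinite.exists_notMem_finset s
  let κ : End F V := LinearMap.id - ι ∘ₗ ρ
  let M : End F V := ι ∘ₗ D ∘ₗ ρ + κ ∘ₗ P ∘ₗ ι ∘ₗ ρ + a • κ
  refine ⟨ι ∘ₗ Y ∘ₗ ρ, M, insert a s, ?_, ?_, ?_⟩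
  · exact (Nat.mul_le_mul_left 2 (LinearMap.finrank_range_comp_comp_le ι Y ρ)).trans hY
  · have hint : ρ ∘ₗ M = D ∘ₗ ρ := by
      ext y; simp [M, κ, hρ]
    ext x
    rw [aeval_rootPoly_insert' ha]
    have h := LinearMap.congr_fun (LinearMap.comp_aeval_of_comp_eq hint (rootPoly s)) x
    rw [hs] at h
    simp only [LinearMap.comp_apply, LinearMap.zero_apply] at h
    simp [M, κ, h]
  · intro x
    refine ⟨_, hmod x, ?_⟩
    simp [M, κ, hρ]
    abel

section Slots

variable {F E W : Type*} [Field F] [AddCommGroup E] [Module F E] [AddCommGroup W] [Module F W]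

/-- The map with diagonal matrix `[diag d | 0]` in the given bases. -/
noncomputable def diagMap {ι κ : Type*} (a : Basis ι F W) (b : Basis (ι ⊕ κ) F E) (d : ι → F) :
    E →ₗ[F] W :=
  b.constr F (Sum.elim (fun i => d i • a i) 0)

@[simp] theorem diagMap_inl {ι κ : Type*} (a : Basis ι F W) (b : Basis (ι ⊕ κ) F E) (d : ι → F)
    (i : ι) : diagMap a b d (b (Sum.inl i)) = d i • a i := by
  simp [diagMap]

@[simp] theorem diagMap_inr {ι κ : Type*} (a : Basis ι F W) (b : Basis (ι ⊕ κ) F E) (d : ι → F)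
    (j : κ) : diagMap a b d (b (Sum.inr j)) = 0 := by
  simp [diagMap]

theorem eq_diagMap {ι κ : Type*} {a : Basis ι F W} {b : Basis (ι ⊕ κ) F E} {d : ι → F}
    {T : E →ₗ[F] W} (h₁ : ∀ i, T (b (Sum.inl i)) = d i • a i) (h₂ : ∀ j, T (b (Sum.inr j)) = 0) :
    T = diagMap a b d := by
  refine b.ext ?_
  rintro (i | j)
  · rw [h₁, diagMap_inl]
  · rw [h₂, diagMap_inr]

/-- In common bases `A` is diagonal, and `B` is diagonal up to a matrix of rank at most half the
dimension of the source. -/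
def SplitsDiagonally (A B : E →ₗ[F] W) : Prop :=
  ∃ (ι κ : Type) (_ : Fintype ι) (_ : Fintype κ) (a : Basis ι F W) (b : Basis (ι ⊕ κ) F E)
    (d₁ d₂ : ι → F) (H : E →ₗ[F] W), 2 * finrank F (LinearMap.range H) ≤ finrank F E ∧
    A = diagMap a b d₁ ∧ B = diagMap a b d₂ + H

theorem SplitsDiagonally.of_equiv {E' W' : Type*} [AddCommGroup E'] [Module F E'] [AddCommGroup W']
    [Module F W'] [FiniteDimensional F W'] {A B : E →ₗ[F] W} {A' B' : E' →ₗ[F] W'}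
    (h : SplitsDiagonally A' B') (e : E ≃ₗ[F] E') (w : W ≃ₗ[F] W')
    (hA : ∀ x, w (A x) = A' (e x)) (hB : ∀ x, w (B x) = B' (e x)) : SplitsDiagonally A B := by
  obtain ⟨ι, κ, _, _, a, b, d₁, d₂, H, hH, rfl, rfl⟩ := h
  refine ⟨ι, κ, ‹_›, ‹_›, a.map w.symm, b.map e.symm, d₁, d₂,
    w.symm.toLinearMap ∘ₗ H ∘ₗ e.toLinearMap, ?_, ?_, ?_⟩
  · rw [e.finrank_eq]
    exact (Nat.mul_le_mul_left 2 (LinearMap.finrank_range_comp_comp_le _ _ _)).trans hH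
  · refine eq_diagMap (fun i => w.injective ?_) (fun i => w.injective ?_) <;> simp [hA]
  · rw [← sub_eq_iff_eq_add]
    refine eq_diagMap (fun i => w.injective ?_) (fun i => w.injective ?_) <;> simp [hB]

theorem LinearMap.exists_rank_normal_form [FiniteDimensional F E] [FiniteDimensional F W]
    (T : E →ₗ[F] W) : ∃ (k l : ℕ) (e : E ≃ₗ[F] (Fin (finrank F (range T)) → F) × (Fin k → F))
      (w : W ≃ₗ[F] (Fin (finrank F (range T)) → F) × (Fin l → F)), ∀ x, w (T x) = ((e x).1, 0) := by
  obtain ⟨C, hC⟩ := Submodule.exists_isCompl (ker T)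
  obtain ⟨D, hD⟩ := Submodule.exists_isCompl (range T)
  let eC := T.kerComplementEquivRange hC.symm
  let bR := (finBasis F (range T)).equivFun
  let bK := (finBasis F (ker T)).equivFun
  let bD := (finBasis F D).equivFun
  refine ⟨_, _, (Submodule.prodEquivOfIsCompl C (ker T) hC.symm).symm ≪≫ₗ
      (eC ≪≫ₗ bR).prodCongr bK,
    (Submodule.prodEquivOfIsCompl (range T) D hD).symm ≪≫ₗ bR.prodCongr bD, fun x => ?_⟩
  obtain ⟨⟨c, y⟩, rfl⟩ := (Submodule.prodEquivOfIsCompl C (ker T) hC.symm).surjective x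
  have h1 : T (Submodule.prodEquivOfIsCompl C (ker T) hC.symm (c, y)) = (eC c : W) := by
    simp [eC]
  rw [h1]
  have h2 : (Submodule.prodEquivOfIsCompl (range T) D hD).symm (eC c : W) = (eC c, 0) := by
    simp
  simp only [LinearEquiv.trans_apply, h2, LinearEquiv.symm_apply_apply]
  simp

theorem exists_eq_diagMap [FiniteDimensional F E] [FiniteDimensional F W]
    (h : finrank F W ≤ finrank F E) (T : E →ₗ[F] W) :
    ∃ (ι κ : Type) (_ : Fintype ι) (_ : Fintype κ) (a : Basis ι F W) (b : Basis (ι ⊕ κ) F E)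
      (d : ι → F), T = diagMap a b d := by
  obtain ⟨k, l, e, w, hT⟩ := T.exists_rank_normal_form
  have hlk : l ≤ k := by
    have h1 := e.finrank_eq
    have h2 := w.finrank_eq
    simp at h1 h2
    omega
  obtain ⟨q, rfl⟩ := Nat.exists_eq_add_of_le hlk
  refine ⟨_, _, inferInstance, inferInstance,
    ((Pi.basisFun F (Fin (finrank F (LinearMap.range T)))).prod (Pi.basisFun F (Fin l))).map w.symm,
    (((Pi.basisFun F (Fin (finrank F (LinearMap.range T)))).prod
      ((Pi.basisFun F (Fin (l + q))).reindex finSumFinEquiv.symm)).reindex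
        (Equiv.sumAssoc _ _ _).symm).map e.symm, Sum.elim 1 0, eq_diagMap ?_ ?_⟩
  · rintro (i | i) <;> refine w.injective ?_ <;> simp [hT]
  · intro j
    refine w.injective ?_
    simp [hT]

theorem LinearMap.exists_comp_comp_eq_self (f : E →ₗ[F] W) :
    ∃ g : W →ₗ[F] E, ∀ x, f (g (f x)) = f x := by
  obtain ⟨σ, hσ⟩ := f.rangeRestrict.exists_rightInverse_of_surjective f.range_rangeRestrict
  obtain ⟨g, hg⟩ := LinearMap.exists_extend σ
  refine ⟨g, fun x => ?_⟩
  have h1 := LinearMap.congr_fun hg (f.rangeRestrict x)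
  have h2 := congrArg Subtype.val (LinearMap.congr_fun hσ (f.rangeRestrict x))
  simp at h1 h2
  rw [h1, h2]

theorem LinearMap.exists_retract_of_finrank_le {A B X Y : Type*} [AddCommGroup A] [Module F A]
    [AddCommGroup B] [Module F B] [AddCommGroup X] [Module F X] [AddCommGroup Y] [Module F Y]
    [FiniteDimensional F A] [FiniteDimensional F B] (f : X →ₗ[F] A) (g : Y →ₗ[F] B)
    (h : finrank F (range f) ≤ finrank F (range g)) :
    ∃ (J : A →ₗ[F] B) (Z : B →ₗ[F] A), (∀ x, Z (J (f x)) = f x) ∧ ∀ x, J (f x) ∈ range g := by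
  let bf := finBasis F (range f)
  let bg := finBasis F (range g)
  let j : range f →ₗ[F] range g := bf.constr F (fun i => bg (Fin.castLE h i))
  let z : range g →ₗ[F] range f :=
    bg.constr F (fun i => if hi : (i : ℕ) < finrank F (range f) then bf ⟨i, hi⟩ else 0)
  have hzj : z ∘ₗ j = LinearMap.id := by
    refine bf.ext fun i => ?_
    simp only [LinearMap.comp_apply, j, z, Basis.constr_basis]
    simp
  obtain ⟨J, hJ⟩ := LinearMap.exists_extend ((range g).subtype ∘ₗ j)
  obtain ⟨Z, hZ⟩ := LinearMap.exists_extend ((range f).subtype ∘ₗ z)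
  have hJ' : ∀ x, J (f x) = j (f.rangeRestrict x) := fun x =>
    LinearMap.congr_fun hJ (f.rangeRestrict x)
  refine ⟨J, Z, fun x => ?_, fun x => by rw [hJ']; exact Subtype.property _⟩
  rw [hJ']
  have h1 := LinearMap.congr_fun hZ (j (f.rangeRestrict x))
  have h2 := congrArg Subtype.val (LinearMap.congr_fun hzj (f.rangeRestrict x))
  simp only [LinearMap.comp_apply, Submodule.subtype_apply, LinearMap.id_apply] at h1 h2
  rw [h1, h2]
  rfl

/-- Two off-diagonal blocks can be completed to a block matrix whose rank is the larger of the
ranks of the two blocks. -/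
theorem exists_block_completion {V : Type*} [AddCommGroup V] [Module F V] [FiniteDimensional F V]
    [FiniteDimensional F E] [FiniteDimensional F W] (Q : E →ₗ[F] V) (R : V →ₗ[F] W) :
    ∃ (Y : W →ₗ[F] E) (D : E →ₗ[F] W),
      finrank F (LinearMap.range (((Q ∘ₗ Y ∘ₗ R).coprod Q).prod (R.coprod D))) ≤
        max (finrank F (LinearMap.range Q)) (finrank F (LinearMap.range R)) := by
  obtain ⟨G, hG⟩ := Q.exists_comp_comp_eq_self
  rcases le_total (finrank F (LinearMap.range R)) (finrank F (LinearMap.range Q)) with h | h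
  · obtain ⟨J, Z, hZ, hJ⟩ := LinearMap.exists_retract_of_finrank_le R Q h
    have hQG : ∀ v, Q (G (J (R v))) = J (R v) := by
      intro v
      obtain ⟨x, hx⟩ := hJ v
      rw [← hx, hG]
    refine ⟨G ∘ₗ J, Z ∘ₗ Q, le_max_of_le_left ?_⟩
    have : ((Q ∘ₗ (G ∘ₗ J) ∘ₗ R).coprod Q).prod (R.coprod (Z ∘ₗ Q)) =
        (LinearMap.id.prod Z) ∘ₗ Q ∘ₗ ((G ∘ₗ J ∘ₗ R).coprod LinearMap.id) := by
      ext x <;> simp [hQG, hZ]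
    rw [this]
    exact LinearMap.finrank_range_comp_comp_le _ _ _
  · obtain ⟨J, Z, hZ, hJ⟩ := LinearMap.exists_retract_of_finrank_le Q R h
    obtain ⟨G', hG'⟩ := R.exists_comp_comp_eq_self
    have hRG : ∀ v, R (G' (J (Q v))) = J (Q v) := by
      intro v
      obtain ⟨x, hx⟩ := hJ v
      rw [← hx, hG']
    refine ⟨G ∘ₗ Z, J ∘ₗ Q, le_max_of_le_right ?_⟩
    have : ((Q ∘ₗ (G ∘ₗ Z) ∘ₗ R).coprod Q).prod (R.coprod (J ∘ₗ Q)) =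
        ((Q ∘ₗ G ∘ₗ Z).prod LinearMap.id) ∘ₗ R ∘ₗ (LinearMap.id.coprod (G' ∘ₗ J ∘ₗ Q)) := by
      ext x <;> simp [hRG, hZ, hG]
    rw [this]
    exact LinearMap.finrank_range_comp_comp_le _ _ _

theorem splitsDiagonally_block [Infinite F] {V : Type*} [AddCommGroup V] [Module F V]
    [FiniteDimensional F V] [FiniteDimensional F E] [FiniteDimensional F W]
    (hdim : finrank F W ≤ finrank F E) (P : End F V) (Q : E →ₗ[F] V) (R : V →ₗ[F] W)
    (hRQ : ∀ x, R (Q x) = 0) :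
    SplitsDiagonally ((LinearMap.inl F V W) ∘ₗ (LinearMap.fst F V E))
      ((P.coprod Q).prod (R ∘ₗ LinearMap.fst F V E)) := by
  let K := LinearMap.ker R
  obtain ⟨ρ, hρ⟩ := K.subtype.exists_leftInverse_of_injective K.ker_subtype
  let I : Submodule F K := (LinearMap.range Q).comap K.subtype
  obtain ⟨X, M, s, hX, hM, hmod⟩ := exists_perturb_diagonalizable_mod (ι := K.subtype) (ρ := ρ)
    (fun x => LinearMap.congr_fun hρ x) I.mkQ_surjective P
  have hQK : LinearMap.range Q ≤ K := by
    rintro _ ⟨x, rfl⟩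
    exact hRQ x
  have hI : finrank F I = finrank F (LinearMap.range Q) := by
    rw [← Submodule.finrank_map_subtype_eq K I, Submodule.map_comap_subtype, inf_eq_right.2 hQK]
  have hIK := Submodule.finrank_quotient_add_finrank I
  have hRK : _ + finrank F K = _ := R.finrank_range_add_finrank_ker
  have hmod' : ∀ x ∈ K, ∃ y, Q y = P x - X x - M x := by
    intro x hx
    obtain ⟨y, hy, h⟩ := hmod ⟨x, hx⟩
    have hy' : y ∈ I := by simpa using hy
    obtain ⟨z, hz⟩ := hy'
    exact ⟨z, by rw [hz]; exact h.symm⟩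
  obtain ⟨GQ, hGQ⟩ := Q.exists_comp_comp_eq_self
  obtain ⟨GR, hGR⟩ := R.exists_comp_comp_eq_self
  let N : End F V := P - X - M
  let κ : End F V := LinearMap.id - K.subtype ∘ₗ ρ
  have hκ : ∀ x ∈ K, κ x = 0 := by
    intro x hx
    have := LinearMap.congr_fun hρ ⟨x, hx⟩
    simp at this
    simp [κ, this]
  have hN : ∀ x, Q (GQ (N (ρ x))) + N (κ (GR (R x))) = N x := by
    intro x
    obtain ⟨y, hy⟩ := hmod' (ρ x) (ρ x).2
    have h1 : Q (GQ (N (ρ x))) = N (ρ x) := by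
      have : N (ρ x) = Q y := hy.symm
      rw [this, hGQ]
    have h2 : κ (GR (R x)) = κ x := by
      rw [← sub_eq_zero, ← map_sub]
      refine hκ _ ?_
      simp [K, hGR]
    rw [h1, h2, ← map_add]
    simp [κ]
  obtain ⟨Y, D, hYD⟩ := exists_block_completion Q R
  obtain ⟨g, μ, hg⟩ := exists_eigenbasis hM
  obtain ⟨ι₂, κ₂, _, _, a₂, b₂, d, hd⟩ := exists_eq_diagMap hdim (-D)
  set H : V × E →ₗ[F] V × W := LinearMap.inl F V W ∘ₗ X ∘ₗ LinearMap.fst F V E +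
    ((Q ∘ₗ Y ∘ₗ R).coprod Q).prod (R.coprod D) with hH
  have hHrank : finrank F (LinearMap.range H) ≤ finrank F (LinearMap.range X) +
      max (finrank F (LinearMap.range Q)) (finrank F (LinearMap.range R)) :=
    (LinearMap.finrank_range_add_le _ _).trans
      (add_le_add (LinearMap.finrank_range_comp_comp_le _ _ _) hYD)
  have hQE := Q.finrank_range_le
  have hRW := (LinearMap.range R).finrank_le
  have hsplit : SplitsDiagonally ((LinearMap.inl F V W) ∘ₗ (LinearMap.fst F V E))
      (M.prodMap (-D) + H) := by
    refine ⟨_, κ₂, inferInstance, ‹_›, g.prod a₂, (g.prod b₂).reindex (Equiv.sumAssoc _ _ _).symm,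
      Sum.elim 1 0, Sum.elim μ d, H, ?_, eq_diagMap ?_ ?_, congrArg (· + H) (eq_diagMap ?_ ?_)⟩
    · rw [finrank_prod]
      omega
    · rintro (i | i) <;> simp
    · intro j; simp
    · rw [hd]
      rintro (i | i) <;> simp [hg]
    · rw [hd]
      intro j; simp
  let k : V →ₗ[F] E := Y ∘ₗ R - GQ ∘ₗ N ∘ₗ K.subtype ∘ₗ ρ
  let l : W →ₗ[F] V := -(N ∘ₗ κ ∘ₗ GR)
  let w : (V × W) ≃ₗ[F] V × W :=
    LinearEquiv.ofLinearMap ((LinearMap.id.coprod l).prod (LinearMap.snd F V W))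
      ((LinearMap.id.coprod (-l)).prod (LinearMap.snd F V W))
      (by ext <;> simp) (by ext <;> simp)
  let e : (V × E) ≃ₗ[F] V × E :=
    LinearEquiv.ofLinearMap ((LinearMap.fst F V E).prod ((-k).coprod LinearMap.id))
      ((LinearMap.fst F V E).prod (k.coprod LinearMap.id))
      (by ext <;> simp) (by ext <;> simp)
  refine hsplit.of_equiv e w ?_ ?_
  · rintro ⟨v, x⟩
    simp [e, w]
  · rintro ⟨v, x⟩
    have := hN v
    have hPN : P v = N v + X v + M v := by simp [N]; abel
    ext1
    · simp only [e, w, hH, k, l]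
      simp [hPN, ← this]
      abel
    · simp [e, w, hH]
      abel

end Slots

section MaxRank

open Filter Topology

theorem splitsDiagonally_of_max_rank {𝕜 E W : Type*} [RCLike 𝕜] [AddCommGroup E] [Module 𝕜 E]
    [AddCommGroup W] [Module 𝕜 W] [FiniteDimensional 𝕜 E] [FiniteDimensional 𝕜 W]
    (hdim : finrank 𝕜 W ≤ finrank 𝕜 E) (A B : E →ₗ[𝕜] W)
    (hmax : ∀ t : 𝕜, finrank 𝕜 (LinearMap.range (A + t • B)) ≤ finrank 𝕜 (LinearMap.range A)) :
    SplitsDiagonally A B := by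
  obtain ⟨r, hr, k, l, e, w, hA⟩ : ∃ r, finrank 𝕜 (LinearMap.range A) = r ∧
      ∃ (k l : ℕ) (e : E ≃ₗ[𝕜] (Fin r → 𝕜) × (Fin k → 𝕜))
        (w : W ≃ₗ[𝕜] (Fin r → 𝕜) × (Fin l → 𝕜)), ∀ x, w (A x) = ((e x).1, 0) :=
    ⟨_, rfl, A.exists_rank_normal_form⟩
  let B' := w.toLinearMap ∘ₗ B ∘ₗ e.symm.toLinearMap
  let P : End 𝕜 (Fin r → 𝕜) := LinearMap.fst _ _ _ ∘ₗ B' ∘ₗ LinearMap.inl _ _ _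
  let Q : (Fin k → 𝕜) →ₗ[𝕜] (Fin r → 𝕜) := LinearMap.fst _ _ _ ∘ₗ B' ∘ₗ LinearMap.inr _ _ _
  let R : (Fin r → 𝕜) →ₗ[𝕜] (Fin l → 𝕜) := LinearMap.snd _ _ _ ∘ₗ B' ∘ₗ LinearMap.inl _ _ _
  let S : (Fin k → 𝕜) →ₗ[𝕜] (Fin l → 𝕜) := LinearMap.snd _ _ _ ∘ₗ B' ∘ₗ LinearMap.inr _ _ _
  have hB' : ∀ v x, B' (v, x) = (P v + Q x, R v + S x) := by
    intro v x
    have : ((v, x) : (Fin r → 𝕜) × (Fin k → 𝕜)) = (v, 0) + (0, x) := by simp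
    rw [this, map_add]
    rfl
  let N : 𝕜 → Matrix (Fin r) (Fin r) 𝕜 := fun t => 1 + t • LinearMap.toMatrix' P
  have hN : Continuous N := by fun_prop
  have hdet : ∀ᶠ t in 𝓝 (0 : 𝕜), (N t).det ≠ 0 := by
    refine hN.matrix_det.continuousAt.eventually_ne ?_
    simp [N]
  let y : (Fin k → 𝕜) → 𝕜 → (Fin r → 𝕜) := fun x t => (N t).adjugate.mulVec (Q x)
  have hy : ∀ x, Continuous (y x) := fun x => hN.matrix_adjugate.matrix_mulVec continuous_const
  have hNP : ∀ t v, (N t).mulVec v = v + t • P v := by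
    intro t v
    simp [N, Matrix.add_mulVec, Matrix.smul_mulVec, LinearMap.toMatrix'_mulVec]
  have hNy : ∀ x t, y x t + t • P (y x t) = (N t).det • Q x := by
    intro x t
    rw [← hNP]
    simp [y, Matrix.mul_adjugate, Matrix.smul_mulVec]
  have key : ∀ x t, (N t).det ≠ 0 → t • ((N t).det • S x) = t • (t • R (y x t)) := by
    intro x t ht
    let T := LinearMap.inl 𝕜 _ _ ∘ₗ LinearMap.fst 𝕜 (Fin r → 𝕜) (Fin k → 𝕜) + t • B'
    have hT : finrank 𝕜 (LinearMap.range T) ≤ finrank 𝕜 (Fin r → 𝕜) := by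
      have : T = w.toLinearMap ∘ₗ (A + t • B) ∘ₗ e.symm.toLinearMap := by
        refine LinearMap.ext fun z => ?_
        simp [T, B', hA]
      rw [this]
      refine (LinearMap.finrank_range_comp_comp_le _ _ _).trans ((hmax t).trans ?_)
      simp [hr]
    let f : LinearMap.range T →ₗ[𝕜] (Fin r → 𝕜) := LinearMap.fst _ _ _ ∘ₗ Submodule.subtype _
    have hf : Function.Surjective f := by
      intro v
      refine ⟨⟨T ((N t)⁻¹.mulVec v, 0), _, rfl⟩, ?_⟩
      have h1 : (N t).mulVec ((N t)⁻¹.mulVec v) = v := by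
        rw [Matrix.mulVec_mulVec, Matrix.mul_nonsing_inv _ ht.isUnit, Matrix.one_mulVec]
      rw [hNP] at h1
      simpa [f, T, hB'] using h1
    have hfr : finrank 𝕜 (LinearMap.range T) = finrank 𝕜 (Fin r → 𝕜) :=
      le_antisymm hT (f.finrank_le_finrank_of_surjective hf)
    have hinj := (LinearMap.injective_iff_surjective_of_finrank_eq_finrank hfr).2 hf
    have h2 : T (-(t • y x t), (N t).det • x) = (0, t • ((N t).det • S x - t • R (y x t))) := by
      have h3 := hNy x t
      simp [T, hB', ← h3]
      module
    have h4 : (⟨T (-(t • y x t), (N t).det • x), _, rfl⟩ : LinearMap.range T) = 0 := by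
      refine hinj ?_
      simp only [map_zero]
      change (T _).1 = 0
      rw [h2]
    have h5 := congrArg Subtype.val h4
    simp only [h2] at h5
    have h6 := congrArg Prod.snd h5
    simpa [smul_sub, sub_eq_zero] using h6
  have key' : ∀ x, ∀ᶠ t in 𝓝[≠] (0 : 𝕜), (N t).det • S x = t • R (y x t) := by
    intro x
    filter_upwards [self_mem_nhdsWithin, nhdsWithin_le_nhds hdet] with t h0 ht
    exact smul_right_injective _ h0 (key x t ht)
  have hRc : Continuous R := R.continuous_of_finiteDimensional
  have hS : ∀ x, S x = 0 := by
    intro x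
    have h1 : Continuous fun t => (N t).det • S x := hN.matrix_det.smul continuous_const
    have h2 : Continuous fun t => t • R (y x t) := continuous_id.smul (hRc.comp (hy x))
    have := tendsto_nhds_unique_of_eventuallyEq
      (h1.tendsto 0 |>.mono_left nhdsWithin_le_nhds) (h2.tendsto 0 |>.mono_left nhdsWithin_le_nhds)
      (key' x)
    simpa [N] using this
  have hRQ : ∀ x, R (Q x) = 0 := by
    intro x
    have h2 : Continuous fun t => R (y x t) := hRc.comp (hy x)
    have := tendsto_nhds_unique_of_eventuallyEq
      (h2.tendsto 0 |>.mono_left nhdsWithin_le_nhds) (tendsto_const_nhds (x := 0)) (by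
        filter_upwards [self_mem_nhdsWithin, key' x] with t h0 ht
        rw [hS, smul_zero, eq_comm, smul_eq_zero] at ht
        exact ht.resolve_left h0)
    simpa [N, y] using this
  have hlk : l ≤ k := by
    have h1 := e.finrank_eq
    have h2 := w.finrank_eq
    simp at h1 h2
    omega
  refine (splitsDiagonally_block (by simpa using hlk) P Q R hRQ).of_equiv e w ?_ ?_
  · intro x
    simp [hA]
  · intro x
    have h1 := hB' (e x).1 (e x).2
    simp only [hS, add_zero] at h1
    have h2 : w (B x) = B' (e x) := by simp [B']
    simp at h1 ⊢
    rw [h2, h1]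

end MaxRank

section Rank

variable {F E W γ : Type*} [Field F] [AddCommGroup E] [Module F E] [AddCommGroup W] [Module F W]

/-- The family of linear maps `T` is a tensor of rank at most `r`. -/
def HasRankLE (T : γ → E →ₗ[F] W) (r : ℕ) : Prop :=
  ∃ (a : Fin r → W) (b : Fin r → Dual F E) (c : Fin r → γ → F),
    ∀ k, T k = ∑ i, c i k • (b i).smulRight (a i)

namespace HasRankLE

theorem of_card_le {ι : Type*} [Fintype ι] {T : γ → E →ₗ[F] W} {r : ℕ} (hr : Fintype.card ι ≤ r)
    (a : ι → W) (b : ι → Dual F E) (c : ι → γ → F)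
    (h : ∀ k, T k = ∑ i, c i k • (b i).smulRight (a i)) : HasRankLE T r := by
  obtain ⟨f⟩ : Nonempty (ι ↪ Fin r) := Function.Embedding.nonempty_of_card_le (by simpa using hr)
  refine ⟨f.toFun.extend a 0, f.toFun.extend b 0, f.toFun.extend c 0, fun k => ?_⟩
  rw [h]
  refine Fintype.sum_of_injective f f.injective _ _ (fun i hi => ?_) (fun i => ?_)
  · simp only [Set.mem_range] at hi
    simp [Function.extend_apply' _ _ _ hi]
  · simp [f.injective.extend_apply]

theorem mono {T : γ → E →ₗ[F] W} {r s : ℕ} (h : HasRankLE T r) (hrs : r ≤ s) : HasRankLE T s := by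
  obtain ⟨a, b, c, h⟩ := h
  exact of_card_le (by simpa using hrs) a b c h

theorem zero : HasRankLE (fun _ : γ => (0 : E →ₗ[F] W)) 0 :=
  ⟨0, 0, 0, by simp⟩

theorem add {S T : γ → E →ₗ[F] W} {r s : ℕ} (hS : HasRankLE S r) (hT : HasRankLE T s) :
    HasRankLE (fun k => S k + T k) (r + s) := by
  obtain ⟨a, b, c, h⟩ := hS
  obtain ⟨a', b', c', h'⟩ := hT
  exact of_card_le (ι := Fin r ⊕ Fin s) (by simp) (Sum.elim a a') (Sum.elim b b') (Sum.elim c c')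
    fun k => by simp [h, h']

theorem sum {J : Type*} (s : Finset J) {T : J → γ → E →ₗ[F] W} {r : ℕ}
    (h : ∀ j, HasRankLE (T j) r) : HasRankLE (fun k => ∑ j ∈ s, T j k) (s.card * r) := by
  classical
  induction s using Finset.induction_on with
  | empty => simpa using zero
  | insert j s hj ih =>
    simp only [Finset.sum_insert hj, Finset.card_insert_of_notMem hj]
    exact ((h j).add ih).mono (by rw [Nat.add_mul, one_mul, add_comm])

/-- Taking linear combinations of slices does not increase the rank. -/
theorem recombine {δ : Type*} [Fintype γ] {T : γ → E →ₗ[F] W} {r : ℕ} (h : HasRankLE T r)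
    (g : δ → γ → F) : HasRankLE (fun k => ∑ j, g k j • T j) r := by
  obtain ⟨a, b, c, h⟩ := h
  refine ⟨a, b, fun i k => ∑ j, g k j * c i j, fun k => ?_⟩
  simp only [h, Finset.smul_sum, Finset.sum_smul, mul_smul]
  exact Finset.sum_comm

theorem comp {E' W' : Type*} [AddCommGroup E'] [Module F E'] [AddCommGroup W'] [Module F W']
    {T : γ → E →ₗ[F] W} {r : ℕ} (h : HasRankLE T r) (f : W →ₗ[F] W') (g : E' →ₗ[F] E) :
    HasRankLE (fun k => f ∘ₗ T k ∘ₗ g) r := by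
  obtain ⟨a, b, c, h⟩ := h
  refine ⟨fun i => f (a i), fun i => b i ∘ₗ g, c, fun k => LinearMap.ext fun x => ?_⟩
  simp [h, LinearMap.sum_apply, map_sum]

theorem smul_const [FiniteDimensional F W] (H : E →ₗ[F] W) (c : γ → F) :
    HasRankLE (fun k => c k • H) (finrank F (LinearMap.range H)) := by
  let g := finBasis F (LinearMap.range H)
  refine ⟨fun i => g i, fun i => g.coord i ∘ₗ H.rangeRestrict, fun _ => c,
    fun k => LinearMap.ext fun x => ?_⟩
  have := congrArg Subtype.val (g.sum_repr (H.rangeRestrict x))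
  simp only [Submodule.coe_sum, Submodule.coe_smul] at this
  simp only [LinearMap.sum_apply, LinearMap.smul_apply, LinearMap.smulRight_apply, ← Finset.smul_sum,
    LinearMap.comp_apply, Basis.coord_apply]
  rw [this]
  rfl

theorem diagMap {ι κ : Type*} [Fintype ι] (a : Basis ι F W) (b : Basis (ι ⊕ κ) F E)
    (c : γ → ι → F) : HasRankLE (fun k => diagMap a b (c k)) (Fintype.card ι) := by
  classical
  refine of_card_le le_rfl a (fun i => b.coord (Sum.inl i)) (fun i k => c k i) fun k => ?_
  refine (eq_diagMap (fun i => ?_) fun j => ?_).symm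
  · simp [LinearMap.sum_apply, Finsupp.single_apply, ite_smul, Finset.sum_ite_eq]
  · simp [LinearMap.sum_apply]

end HasRankLE

end Rank

section Pair

open Filter Topology Matrix

variable {𝕜 : Type*} [RCLike 𝕜]

theorem contDiff_det {X τ : Type*} [Fintype τ] [DecidableEq τ] [NormedAddCommGroup X]
    [NormedSpace 𝕜 X] {M : X → Matrix τ τ 𝕜} (h : ∀ i j, ContDiff 𝕜 1 fun x => M x i j) :
    ContDiff 𝕜 1 fun x => (M x).det := by
  simp only [Matrix.det_apply]
  exact ContDiff.sum fun σ _ => (contDiff_prod fun i _ => h _ _).const_smul _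

/-- A simple root of `f (0, ·)` persists under small changes of the parameter. -/
theorem eventually_exists_root {f : 𝕜 × 𝕜 → 𝕜} (hf : ContDiff 𝕜 1 f) {x d : 𝕜} (h0 : f (0, x) = 0)
    (hd : HasDerivAt (fun y => f (0, y)) d x) (hd0 : d ≠ 0) {U : Set 𝕜} (hU : U ∈ 𝓝 x) :
    ∀ᶠ ε in 𝓝 (0 : 𝕜), ∃ y ∈ U, f (ε, y) = 0 := by
  obtain ⟨f', hf'⟩ : ∃ f' : 𝕜 × 𝕜 →L[𝕜] 𝕜, HasStrictFDerivAt f f' (0, x) :=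
    ⟨_, hf.contDiffAt.hasStrictFDerivAt one_ne_zero⟩
  have hd' : f' (0, 1) = d := by
    have h1 : HasDerivAt (fun y : 𝕜 => ((0 : 𝕜), y)) (0, 1) x :=
      (hasDerivAt_const x 0).prodMk (hasDerivAt_id x)
    exact (hf'.hasFDerivAt.comp_hasDerivAt x h1).unique hd
  have hG := (hasStrictFDerivAt_fst (𝕜 := 𝕜) (p := ((0 : 𝕜), x))).prodMk hf'
  have hsurj : ((ContinuousLinearMap.fst 𝕜 𝕜 𝕜).prod f').range = ⊤ := by
    rw [LinearMap.range_eq_top]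
    rintro ⟨u, v⟩
    refine ⟨(u, (v - f' (u, 0)) / d), ?_⟩
    have h2 : ((u, (v - f' (u, 0)) / d) : 𝕜 × 𝕜) = (u, 0) + ((v - f' (u, 0)) / d) • (0, 1) := by
      simp
    refine Prod.ext rfl ?_
    change f' (u, (v - f' (u, 0)) / d) = v
    rw [h2, map_add, map_smul, hd', smul_eq_mul, div_mul_cancel₀ _ hd0]
    ring
  have hmap := hG.map_nhds_eq_of_surj hsurj
  have hmem : (fun p : 𝕜 × 𝕜 => (p.1, f p)) '' (Set.univ ×ˢ U) ∈ 𝓝 ((0 : 𝕜), (0 : 𝕜)) := by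
    have hmap' := hmap.symm
    rw [h0] at hmap'
    rw [hmap']
    exact image_mem_map (prod_mem_nhds univ_mem hU)
  have hc : Tendsto (fun ε : 𝕜 => (ε, (0 : 𝕜))) (𝓝 0) (𝓝 (0, 0)) :=
    (by fun_prop : Continuous fun ε : 𝕜 => (ε, (0 : 𝕜))).tendsto' _ _ rfl
  filter_upwards [hc hmem] with ε hε
  obtain ⟨⟨ε', y⟩, ⟨-, hy⟩, h⟩ := hε
  simp only [Prod.mk.injEq] at h
  obtain ⟨rfl, h⟩ := h
  exact ⟨y, hy, h⟩

theorem exists_hasRankLE_sub_diagonal {τ : Type*} [Fintype τ] [DecidableEq τ]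
    (C D : Matrix τ τ 𝕜) : ∃ x y : τ → 𝕜,
      HasRankLE (fun s : Bool => toLin' (cond s (C - diagonal x) (D - diagonal y)))
        (Fintype.card τ) := by
  obtain ⟨μ, hμ⟩ : ∃ μ : τ → 𝕜, Function.Injective μ :=
    ⟨_, ((Fintype.equivFin τ).toEmbedding.trans
      (Fin.valEmbedding.trans (Infinite.natEmbedding 𝕜))).injective⟩
  let f : 𝕜 × 𝕜 → 𝕜 := fun p => (diagonal μ + p.1 • D - p.2 • (1 + p.1 • C)).det
  have hf : ContDiff 𝕜 1 f := contDiff_det fun i j => by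
    simp only [Matrix.sub_apply, Matrix.add_apply, Matrix.smul_apply, smul_eq_mul]
    fun_prop
  obtain ⟨U, hU, hdisj⟩ := (Set.finite_range μ).t2_separation
  have hroot : ∀ i, ∀ᶠ ε in 𝓝 (0 : 𝕜), ∃ y ∈ U (μ i), f (ε, y) = 0 := by
    intro i
    have hf0 : (fun y => f (0, y)) = fun y => (μ i - y) * ∏ j ∈ Finset.univ.erase i, (μ j - y) := by
      funext y
      have : diagonal μ + (0 : 𝕜) • D - y • (1 + (0 : 𝕜) • C) = diagonal fun j => μ j - y := by
        ext a b
        by_cases hab : a = b <;> simp [hab]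
      simp only [f, this, det_diagonal]
      exact (Finset.mul_prod_erase _ _ (Finset.mem_univ i)).symm
    have hh : DifferentiableAt 𝕜 (fun y => ∏ j ∈ Finset.univ.erase i, (μ j - y)) (μ i) := by
      fun_prop
    have hder := ((hasDerivAt_id (μ i)).const_sub (μ i)).mul hh.hasDerivAt
    refine eventually_exists_root hf (by simpa using congrFun hf0 (μ i)) (by rw [hf0]; exact hder) ?_
      ((hU _).2.mem_nhds (hU _).1)
    simp only [id, sub_self, zero_mul, add_zero, neg_mul, one_mul, neg_ne_zero]
    refine Finset.prod_ne_zero_iff.2 fun j hj => sub_ne_zero.2 fun h => ?_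
    exact Finset.ne_of_mem_erase hj (hμ h)
  have hdet : ∀ᶠ ε in 𝓝 (0 : 𝕜), (1 + ε • C).det ≠ 0 := by
    have : Continuous fun ε : 𝕜 => (1 + ε • C).det :=
      (by fun_prop : Continuous fun ε : 𝕜 => 1 + ε • C).matrix_det
    exact this.continuousAt.eventually_ne (by simp)
  have hev : ∀ᶠ ε in 𝓝[≠] (0 : 𝕜), ε ≠ 0 ∧ (1 + ε • C).det ≠ 0 ∧
      ∀ i, ∃ y ∈ U (μ i), f (ε, y) = 0 := by
    filter_upwards [self_mem_nhdsWithin, nhdsWithin_le_nhds hdet,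
      nhdsWithin_le_nhds (eventually_all.2 hroot)] with ε h1 h2 h3 using ⟨h1, h2, h3⟩
  obtain ⟨ε, hε, hN, hex⟩ := hev.exists
  choose ν hνU hν using hex
  have hinj : Function.Injective ν := by
    intro i j hij
    by_contra hne
    refine Set.disjoint_left.1 (hdisj ⟨i, rfl⟩ ⟨j, rfl⟩ (hμ.ne hne)) (hνU i) ?_
    rw [hij]
    exact hνU j
  set N := 1 + ε • C with hNdef
  set L := diagonal μ + ε • D with hL
  have hv : ∀ i, ∃ v : τ → 𝕜, v ≠ 0 ∧ (L - ν i • N) *ᵥ v = 0 := fun i =>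
    exists_mulVec_eq_zero_iff.2 (hν i)
  choose v hv0 hv using hv
  have hLv : ∀ i, L *ᵥ v i = ν i • (N *ᵥ v i) := fun i => by
    simpa [sub_mulVec, sub_eq_zero, smul_mulVec] using hv i
  have hli : LinearIndependent 𝕜 v := by
    refine Module.End.eigenvectors_linearIndependent' (toLin' (N⁻¹ * L)) ν hinj v fun i => ?_
    refine Module.End.hasEigenvector_iff.2 ⟨Module.End.mem_eigenspace_iff.2 ?_, hv0 i⟩
    rw [toLin'_apply, ← mulVec_mulVec, hLv, mulVec_smul, mulVec_mulVec,
      nonsing_inv_mul _ hN.isUnit, one_mulVec]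
  let g := basisOfLinearIndependentOfCardEqFinrank' v hli (by simp)
  have hg : ∀ i, g i = v i := fun i => by simp [g]
  have hrepr : ∀ i, g.repr (v i) = Finsupp.single i 1 := fun i => by rw [← hg, g.repr_self]
  have hC : C - diagonal (fun _ => -ε⁻¹) = ε⁻¹ • N := by
    ext i j
    by_cases hij : i = j <;> simp [hNdef, hij, hε, mul_add, add_comm]
  have hD : D - diagonal (fun i => -ε⁻¹ * μ i) = ε⁻¹ • L := by
    ext i j
    by_cases hij : i = j <;> simp [hL, hij, hε, mul_add, add_comm]
  refine ⟨fun _ => -ε⁻¹, fun i => -ε⁻¹ * μ i, HasRankLE.of_card_le le_rfl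
    (fun i => N *ᵥ v i) (fun i => g.coord i)
    (fun i s => cond s ε⁻¹ (ε⁻¹ * ν i)) fun s => ?_⟩
  refine g.ext fun i => ?_
  cases s
  · simp only [cond_false, hD]
    simp [LinearMap.sum_apply, Finsupp.single_apply, hg, hrepr, hLv, mul_smul]
  · simp only [cond_true, hC]
    simp [LinearMap.sum_apply, Finsupp.single_apply, hg, hrepr]

theorem exists_hasRankLE_sub_diagMap {E W ι κ : Type*} [AddCommGroup E] [Module 𝕜 E]
    [AddCommGroup W] [Module 𝕜 W] [Fintype ι] [Fintype κ] (a : Basis ι 𝕜 W)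
    (b : Basis (ι ⊕ κ) 𝕜 E) (C D : E →ₗ[𝕜] W) : ∃ x y : ι → 𝕜,
      HasRankLE (fun s : Bool => cond s (C - diagMap a b x) (D - diagMap a b y))
        (finrank 𝕜 E) := by
  classical
  let j : W →ₗ[𝕜] (ι ⊕ κ → 𝕜) := a.constr 𝕜 fun i => Pi.single (Sum.inl i) 1
  let q : (ι ⊕ κ → 𝕜) →ₗ[𝕜] W := (Pi.basisFun 𝕜 (ι ⊕ κ)).constr 𝕜 (Sum.elim a 0)
  have hqj : ∀ w, q (j w) = w := by
    refine LinearMap.congr_fun (f := q ∘ₗ j) (g := LinearMap.id) (a.ext fun i => ?_)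
    simp [j, q]
  have hdiag : ∀ x : ι ⊕ κ → 𝕜, q ∘ₗ toLin' (diagonal x) ∘ₗ b.equivFun.toLinearMap =
      diagMap a b (x ∘ Sum.inl) := by
    intro x
    refine eq_diagMap (fun i => ?_) fun i => ?_ <;>
      simp [q, mulVec_diagonal, Finsupp.single_apply]
  let K : (E →ₗ[𝕜] W) → Matrix (ι ⊕ κ) (ι ⊕ κ) 𝕜 := fun C =>
    LinearMap.toMatrix' (j ∘ₗ C ∘ₗ b.equivFun.symm.toLinearMap)
  have hK : ∀ C, q ∘ₗ toLin' (K C) ∘ₗ b.equivFun.toLinearMap = C := by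
    intro C
    ext x
    simp [K, hqj]
  obtain ⟨x, y, h⟩ := exists_hasRankLE_sub_diagonal (K C) (K D)
  refine ⟨x ∘ Sum.inl, y ∘ Sum.inl, ?_⟩
  rw [finrank_eq_card_basis b]
  convert h.comp q b.equivFun.toLinearMap using 2 with s
  cases s
  · simp only [cond_false, map_sub, LinearMap.sub_comp, LinearMap.comp_sub, hK, hdiag]
  · simp only [cond_true, map_sub, LinearMap.sub_comp, LinearMap.comp_sub, hK, hdiag]

end Pair

section Assembly

theorem exists_forall_finrank_range_add_smul_le {F E W : Type*} [Field F] [AddCommGroup E]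
    [Module F E] [AddCommGroup W] [Module F W] [FiniteDimensional F W] (A B : E →ₗ[F] W) :
    ∃ t : F, ∀ t' : F, finrank F (LinearMap.range (A + t' • B)) ≤
      finrank F (LinearMap.range (A + t • B)) := by
  let f : F → ℕ := fun t => finrank F (LinearMap.range (A + t • B))
  have hb : BddAbove (Set.range f) := by
    refine ⟨finrank F W, ?_⟩
    rintro _ ⟨t, rfl⟩
    exact Submodule.finrank_le _
  obtain ⟨t, ht⟩ := Nat.sSup_mem (Set.range_nonempty f) hb
  exact ⟨t, fun t' => (le_csSup hb ⟨t', rfl⟩).trans ht.ge⟩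

theorem hasRankLE_of_pairs {𝕜 E W J : Type*} [RCLike 𝕜] [AddCommGroup E] [Module 𝕜 E]
    [AddCommGroup W] [Module 𝕜 W] [FiniteDimensional 𝕜 E] [FiniteDimensional 𝕜 W] [Fintype J]
    (hdim : finrank 𝕜 W ≤ finrank 𝕜 E) (T : Bool ⊕ (J × Bool) → E →ₗ[𝕜] W) :
    HasRankLE T (finrank 𝕜 W + (finrank 𝕜 E / 2 + Fintype.card J * finrank 𝕜 E)) := by
  classical
  set A := T (Sum.inl true) with hA
  set B := T (Sum.inl false) with hB
  obtain ⟨t, ht⟩ := exists_forall_finrank_range_add_smul_le A B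
  obtain ⟨ι, κ, _, _, a, b, d₁, d₂, H, hH, h₁, h₂⟩ :=
    splitsDiagonally_of_max_rank hdim (A + t • B) B fun s => by
      rw [add_assoc, ← add_smul]
      exact ht _
  choose x y hxy using fun j => exists_hasRankLE_sub_diagMap a b
    (T (Sum.inr (j, true))) (T (Sum.inr (j, false)))
  let δ : Bool ⊕ (J × Bool) → ι → 𝕜 :=
    Sum.elim (fun s => cond s (d₁ - t • d₂) d₂) fun q => cond q.2 (x q.1) (y q.1)
  let η : Bool ⊕ (J × Bool) → 𝕜 := Sum.elim (fun s => cond s (-t) 1) 0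
  let g : J → Bool ⊕ (J × Bool) → Bool → 𝕜 := fun j k s => if k = Sum.inr (j, s) then 1 else 0
  have hT := (HasRankLE.diagMap a b δ).add ((HasRankLE.smul_const H η).add
    (HasRankLE.sum Finset.univ fun j => (hxy j).recombine (g j)))
  rw [← finrank_eq_card_basis a, Finset.card_univ] at hT
  refine HasRankLE.mono (r := _) ?_ (Nat.add_le_add_left (Nat.add_le_add_right
    ((Nat.le_div_iff_mul_le two_pos).2 (by rwa [mul_comm])) _) _)
  convert hT using 1
  funext k
  rcases k with (_ | _) | ⟨j, _ | _⟩
  · simp [δ, η, g, ← h₂, hB]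
  · have : diagMap a b (d₁ - t • d₂) = diagMap a b d₁ - t • diagMap a b d₂ := by
      refine (eq_diagMap (fun i => ?_) fun i => ?_).symm <;> simp [sub_smul, mul_smul]
    simp [δ, η, g, this, ← h₁, ← hA]
    rw [h₂]
    module
  · simp [δ, η, g]
  · simp [δ, η, g]

theorem tensorRank_le_of_hasRankLE {F α β γ δ : Type*} [Field F] [Fintype α] [Fintype β]
    [DecidableEq β] [Fintype γ] {A : γ → Matrix α β F} (σ : γ → δ)
    {T : δ → (β → F) →ₗ[F] (α → F)} (hT : ∀ k, T (σ k) = Matrix.toLin' (A k)) {r : ℕ}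
    (h : HasRankLE T r) : tensorRank F A ≤ r := by
  obtain ⟨a, b, c, h⟩ := h
  refine Nat.sInf_le ⟨a, fun i j => b i (Pi.single j 1), fun i k => c i (σ k), fun k => ?_⟩
  ext i j
  have := congrFun (LinearMap.congr_fun ((hT k).symm.trans (h (σ k))) (Pi.single j 1)) i
  simpa [LinearMap.sum_apply, Matrix.sum_apply, Matrix.vecMulVec_apply, mul_comm] using this

end Assembly

end LinearFamilies

/-- If `𝔽` is `ℝ` or `ℂ`, `n ≤ m` and `p` is even, then
`2 * maxRank 𝔽 n m p ≤ m * (p - 1) + 2 * n`. -/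
theorem stmt9 {𝔽 : Type*} [RCLike 𝔽] {n m p : ℕ}
    (hn : 0 < n) (hp : 0 < p) (hnm : n ≤ m) (heven : Even p) :
    2 * maxRank 𝔽 n m p ≤ m * (p - 1) + 2 * n := by
  obtain ⟨q, rfl⟩ := heven
  obtain ⟨k, rfl⟩ : ∃ k, q = k + 1 := ⟨q - 1, by omega⟩
  have hle : maxRank 𝔽 n m (k + 1 + (k + 1)) ≤ n + (m / 2 + k * m) := by
    refine csSup_le ⟨_, 0, rfl⟩ ?_
    rintro _ ⟨A, rfl⟩
    let σ : Fin (k + 1 + (k + 1)) ≃ Bool ⊕ (Fin k × Bool) :=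
      Fintype.equivOfCardEq (by simp; ring)
    have := hasRankLE_of_pairs (by simpa using hnm)
      fun s => Matrix.toLin' (A (σ.symm s))
    simp only [Module.finrank_fin_fun, Fintype.card_fin] at this
    exact tensorRank_le_of_hasRankLE σ (fun k => by simp) this
  have h1 : m * (k + 1 + (k + 1) - 1) = 2 * (k * m) + m := by
    rw [show k + 1 + (k + 1) - 1 = 2 * k + 1 by omega]
    ring
  rw [h1]
  omega
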